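/- There exists γ > 0 such that the following holds: for every K > 0 and every measurable set A ⊆ 𝕋_K² satisfying s(1; A) ≤ γ and δ(A) ≥ m₁(ℝ²) − γ, one has s(1.96; A) ≥ 1 + γ. -/

import Mathlib

open MeasureTheory Filter
open scoped ENNReal

noncomputable section

/-- The Haar measure on the `K × K` torus `𝕋_K² = ℝ²/(Kℤ²)` (total mass `K²`). -/
def torusVolume (K : ℝ) : Measure (AddCircle K × AddCircle K) :=
  if hK : 0 < K then
    haveI : Fact (0 < K) := ⟨hK⟩
    (volume : Measure (AddCircle K × AddCircle K))
  else 0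

/-- Normalized density of a subset of the torus `𝕋_K²`. -/
def density (K : ℝ) (A : Set (AddCircle K × AddCircle K)) : ℝ :=
  (torusVolume K A).toReal / K ^ 2

/-- Autocorrelation function `f(x; A) = δ(A ∩ (A - x))`. -/
def autocorr (K : ℝ) (A : Set (AddCircle K × AddCircle K))
    (x : AddCircle K × AddCircle K) : ℝ :=
  density K (A ∩ (fun y => y + x) ⁻¹' A)

/-- Radialized pair correlation function `f°(r; A)`. -/
def paircorr (K : ℝ) (A : Set (AddCircle K × AddCircle K)) (r : ℝ) : ℝ :=
  (1 / (2 * Real.pi)) * ∫ θ in (0:ℝ)..(2 * Real.pi),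
    autocorr K A (((r * Real.cos θ : ℝ) : AddCircle K), ((r * Real.sin θ : ℝ) : AddCircle K))

/-- Normalized pair correlation `s(r; A) = f°(r; A) / δ(A)²`. -/
def scorr (K : ℝ) (A : Set (AddCircle K × AddCircle K)) (r : ℝ) : ℝ :=
  paircorr K A r / density K A ^ 2

/-- Euclidean distance on `ℝ²`. -/
def euDist (p q : ℝ × ℝ) : ℝ := Real.sqrt ((p.1 - q.1) ^ 2 + (p.2 - q.2) ^ 2)

/-- A planar set avoiding Euclidean distance 1. -/
def Avoids1 (A : Set (ℝ × ℝ)) : Prop := ∀ p ∈ A, ∀ q ∈ A, euDist p q ≠ 1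

/-- Upper density of a planar set. -/
def upperDensity (A : Set (ℝ × ℝ)) : ℝ :=
  limsup (fun R : ℝ => (volume (A ∩ Set.Icc (-R, -R) (R, R))).toReal / (2 * R) ^ 2) atTop

/-- `m₁(ℝ²)`: the supremum of upper densities of measurable 1-avoiding planar sets. -/
def m1Plane : ℝ :=
  sSup {d : ℝ | ∃ A : Set (ℝ × ℝ), MeasurableSet A ∧ Avoids1 A ∧ d = upperDensity A}

end

noncomputable section

/-- The mean of a function of the angle over the circle. -/
def circleMean (f : ℝ → ℝ) : ℝ := (1 / (2 * Real.pi)) * ∫ θ in (0:ℝ)..(2 * Real.pi), f θ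

/-- The Bessel function `J₀`. -/
def besselJ0 (x : ℝ) : ℝ := circleMean fun θ => Real.cos (x * Real.cos θ)

/-- The Bessel function `J₁`. -/
def besselJ1 (x : ℝ) : ℝ := circleMean fun θ => Real.sin (x * Real.cos θ) * Real.cos θ

lemma circleMean_add {f g : ℝ → ℝ} (hf : Continuous f) (hg : Continuous g) :
    circleMean (fun θ => f θ + g θ) = circleMean f + circleMean g := by
  rw [circleMean, intervalIntegral.integral_add (hf.intervalIntegrable _ _)
    (hg.intervalIntegrable _ _), mul_add]; rfl

lemma circleMean_const_mul (c : ℝ) (f : ℝ → ℝ) :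
    circleMean (fun θ => c * f θ) = c * circleMean f := by
  rw [circleMean, intervalIntegral.integral_const_mul, circleMean]; ring

lemma circleMean_const (c : ℝ) : circleMean (fun _ => c) = c := by
  rw [circleMean, intervalIntegral.integral_const, smul_eq_mul, sub_zero]
  field_simp

lemma circleMean_mono {f g : ℝ → ℝ} (hf : Continuous f) (hg : Continuous g)
    (h : ∀ θ, f θ ≤ g θ) : circleMean f ≤ circleMean g :=
  mul_le_mul_of_nonneg_left
    (intervalIntegral.integral_mono_on (by positivity) (hf.intervalIntegrable _ _)
      (hg.intervalIntegrable _ _) fun θ _ => h θ) (by positivity)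

lemma circleMean_sub {f g : ℝ → ℝ} (hf : Continuous f) (hg : Continuous g) :
    circleMean (fun θ => f θ - g θ) = circleMean f - circleMean g := by
  rw [circleMean, intervalIntegral.integral_sub (hf.intervalIntegrable _ _)
    (hg.intervalIntegrable _ _), mul_sub]; rfl

lemma abs_circleMean_le {f : ℝ → ℝ} (hf : Continuous f) :
    |circleMean f| ≤ circleMean fun θ => |f θ| := by
  rw [abs_le, ← neg_one_mul, ← circleMean_const_mul]
  exact ⟨circleMean_mono (by fun_prop) hf fun θ => by linarith [neg_abs_le (f θ)],
    circleMean_mono hf hf.abs fun θ => le_abs_self _⟩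

lemma circleMean_cos_pow_add_two (n : ℕ) :
    circleMean (fun θ => Real.cos θ ^ (n + 2)) =
      (n + 1) / (n + 2) * circleMean fun θ => Real.cos θ ^ n := by
  rw [circleMean, integral_cos_pow, circleMean]
  simp; ring

lemma circleMean_cos_pow_even (k : ℕ) :
    circleMean (fun θ => Real.cos θ ^ (2 * k)) =
      (2 * k).factorial / (4 ^ k * (k.factorial : ℝ) ^ 2) := by
  induction k with
  | zero => simp [circleMean_const]
  | succ k ih =>
    rw [show 2 * (k + 1) = 2 * k + 2 by ring, circleMean_cos_pow_add_two, ih,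
      Nat.factorial_succ, Nat.factorial_succ, Nat.factorial_succ]
    push_cast
    field_simp
    ring

lemma circleMean_cos_sq : circleMean (fun θ => Real.cos θ ^ 2) = 1 / 2 := by
  have := circleMean_cos_pow_even 1
  norm_num [Nat.factorial] at this
  simpa using this

lemma circleMean_cos_pow_mul_sin_sq (k : ℕ) :
    circleMean (fun θ => Real.cos θ ^ (2 * k) * Real.sin θ ^ 2) =
      (2 * k).factorial / (4 ^ k * (k.factorial : ℝ) ^ 2 * (2 * (k + 1))) := by
  have h : (fun θ => Real.cos θ ^ (2 * k) * Real.sin θ ^ 2) =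
      fun θ => Real.cos θ ^ (2 * k) - Real.cos θ ^ (2 * k + 2) := by
    ext θ; rw [Real.sin_sq]; ring
  rw [h, circleMean_sub (by fun_prop) (by fun_prop), circleMean_cos_pow_add_two,
    circleMean_cos_pow_even]
  push_cast
  field_simp
  ring

lemma hasSum_circleMean_cos_mul (x : ℝ) {g : ℝ → ℝ} (hg : Continuous g) (hg1 : ∀ θ, |g θ| ≤ 1) :
    HasSum (fun k : ℕ => (-1) ^ k * x ^ (2 * k) / (2 * k).factorial *
        circleMean fun θ => Real.cos θ ^ (2 * k) * g θ)
      (circleMean fun θ => Real.cos (x * Real.cos θ) * g θ) := by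
  have hs : Summable fun k : ℕ => |x| ^ (2 * k) / (2 * k).factorial := by
    simpa using! (Real.summable_pow_div_factorial |x|).comp_injective
      (mul_right_injective₀ two_ne_zero)
  have key := intervalIntegral.hasSum_integral_of_dominated_convergence (μ := volume)
    (a := 0) (b := 2 * Real.pi)
    (F := fun (k : ℕ) θ => (-1) ^ k * x ^ (2 * k) / (2 * k).factorial *
      (Real.cos θ ^ (2 * k) * g θ))
    (f := fun θ => Real.cos (x * Real.cos θ) * g θ)
    (fun k _ => |x| ^ (2 * k) / (2 * k).factorial)
    (fun k => by fun_prop)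
    (fun k => .of_forall fun θ _ => by
      rw [Real.norm_eq_abs, abs_mul, abs_div, abs_mul, abs_pow, abs_neg, abs_one, one_pow, one_mul,
        abs_pow, Nat.abs_cast, abs_mul, abs_pow]
      refine mul_le_of_le_one_right (by positivity) ?_
      exact mul_le_one₀ (pow_le_one₀ (abs_nonneg _) (Real.abs_cos_le_one θ)) (abs_nonneg _) (hg1 θ))
    (.of_forall fun _ _ => hs) (by simp)
    (.of_forall fun θ _ => by
      have := (Real.hasSum_cos (x * Real.cos θ)).mul_right (g θ)
      refine this.congr_fun ?_ |> fun h => h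
      intro k
      simp only [mul_pow]; ring)
  have := key.mul_left (1 / (2 * Real.pi))
  refine this.congr_fun ?_ |> fun h => h
  intro k
  rw [intervalIntegral.integral_const_mul, circleMean]; ring

lemma hasSum_besselJ0 (x : ℝ) :
    HasSum (fun k : ℕ => (-1) ^ k * (x ^ 2 / 4) ^ k / (k.factorial : ℝ) ^ 2) (besselJ0 x) := by
  have := hasSum_circleMean_cos_mul x (g := fun _ => 1) continuous_const (by simp)
  simp only [mul_one, circleMean_cos_pow_even] at this
  refine this.congr_fun ?_ |> fun h => h
  intro k
  rw [div_pow, ← pow_mul]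
  field_simp

lemma besselJ1_eq (x : ℝ) :
    besselJ1 x = x * circleMean fun θ => Real.cos (x * Real.cos θ) * Real.sin θ ^ 2 := by
  have h := intervalIntegral.integral_mul_deriv_eq_deriv_mul (a := 0) (b := 2 * Real.pi)
    (u := fun θ => Real.sin (x * Real.cos θ)) (v := Real.sin)
    (u' := fun θ => Real.cos (x * Real.cos θ) * (x * -Real.sin θ)) (v' := Real.cos)
    (fun θ _ => ((Real.hasDerivAt_cos θ).const_mul x).sin)
    (fun θ _ => Real.hasDerivAt_sin θ)
    (Continuous.intervalIntegrable (by fun_prop) _ _)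
    (Continuous.intervalIntegrable (by fun_prop) _ _)
  rw [besselJ1, circleMean, h, circleMean, mul_left_comm, ← intervalIntegral.integral_const_mul]
  simp only [Real.sin_two_pi, Real.sin_zero, mul_zero, sub_zero, zero_sub,
    ← intervalIntegral.integral_neg]
  congr 2; ext θ; ring

lemma hasSum_besselJ1 (x : ℝ) :
    HasSum (fun k : ℕ => x / 2 * ((-1) ^ k * (x ^ 2 / 4) ^ k / ((k.factorial : ℝ) ^ 2 * (k + 1))))
      (besselJ1 x) := by
  have := (hasSum_circleMean_cos_mul x (g := fun θ => Real.sin θ ^ 2) (by fun_prop) fun θ => by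
    rw [abs_of_nonneg (sq_nonneg _)]; exact Real.sin_sq_le_one θ).mul_left x
  rw [← besselJ1_eq] at this
  simp only [circleMean_cos_pow_mul_sin_sq] at this
  refine this.congr_fun ?_ |> fun h => h
  intro k
  rw [div_pow, ← pow_mul]
  field_simp

lemma hasDerivAt_circleMean {F F' : ℝ → ℝ → ℝ} (x : ℝ) (hF : ∀ x, Continuous (F x))
    (hF' : ∀ x, Continuous (F' x)) (hb : ∀ x θ, |F' x θ| ≤ 1)
    (hd : ∀ x θ, HasDerivAt (fun x => F x θ) (F' x θ) x) :
    HasDerivAt (fun x => circleMean (F x)) (circleMean (F' x)) x :=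
  (intervalIntegral.hasDerivAt_integral_of_dominated_loc_of_deriv_le (μ := volume)
    (bound := fun _ => 1) univ_mem (.of_forall fun y => (hF y).aestronglyMeasurable)
    ((hF x).intervalIntegrable _ _) (hF' x).aestronglyMeasurable
    (.of_forall fun θ _ y _ => hb y θ) (by simp)
    (.of_forall fun θ _ y _ => hd y θ)).2.const_mul _

lemma hasDerivAt_besselJ0 (x : ℝ) : HasDerivAt besselJ0 (-besselJ1 x) x := by
  have := hasDerivAt_circleMean (F := fun x θ => Real.cos (x * Real.cos θ))
    (F' := fun x θ => -1 * (Real.sin (x * Real.cos θ) * Real.cos θ)) x (fun _ => by fun_prop)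
    (fun _ => by fun_prop)
    (fun y θ => by
      rw [abs_mul, abs_neg, abs_one, one_mul, abs_mul]
      exact mul_le_one₀ (Real.abs_sin_le_one _) (abs_nonneg _) (Real.abs_cos_le_one _))
    (fun y θ => by
      exact ((hasDerivAt_id y).mul_const (Real.cos θ)).cos.congr_deriv (by simp))
  rwa [circleMean_const_mul, neg_one_mul] at this

lemma hasDerivAt_besselJ1 {x : ℝ} (hx : x ≠ 0) :
    HasDerivAt besselJ1 (besselJ0 x - besselJ1 x / x) x := by
  have := hasDerivAt_circleMean (F := fun x θ => Real.sin (x * Real.cos θ) * Real.cos θ)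
    (F' := fun x θ => Real.cos (x * Real.cos θ) * Real.cos θ ^ 2) x (fun _ => by fun_prop)
    (fun _ => by fun_prop)
    (fun y θ => by
      rw [abs_mul, abs_pow]
      exact mul_le_one₀ (Real.abs_cos_le_one _) (by positivity)
        (pow_le_one₀ (abs_nonneg _) (Real.abs_cos_le_one _)))
    (fun y θ => by
      exact (((hasDerivAt_id y).mul_const (Real.cos θ)).sin.mul_const (Real.cos θ)).congr_deriv
        (by simp; ring))
  refine (this.congr_deriv ?_ : HasDerivAt besselJ1 _ x)
  symm
  rw [besselJ1_eq, mul_div_cancel_left₀ _ hx, besselJ0,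
    ← circleMean_sub (by fun_prop) (by fun_prop)]
  congr 1; ext θ
  rw [Real.sin_sq]; ring

/-- A Lyapunov function for Bessel's equation. -/
def besselEnergy (x : ℝ) : ℝ :=
  x * (besselJ0 x ^ 2 + besselJ1 x ^ 2) - besselJ0 x * besselJ1 x + besselJ0 x ^ 2 / (2 * x)

lemma hasDerivAt_besselEnergy {x : ℝ} (hx : x ≠ 0) :
    HasDerivAt besselEnergy (-(besselJ0 x ^ 2 / (2 * x ^ 2))) x := by
  have h0 := hasDerivAt_besselJ0 x
  have h1 := hasDerivAt_besselJ1 hx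
  have := (((hasDerivAt_id x).mul ((h0.pow 2).add (h1.pow 2))).sub (h0.mul h1)).add
    ((h0.pow 2).div ((hasDerivAt_id x).const_mul 2) (by simpa using hx))
  refine (this.congr_deriv ?_ : HasDerivAt besselEnergy _ x)
  simp
  field_simp
  ring

lemma antitoneOn_besselEnergy : AntitoneOn besselEnergy (Set.Ioi 0) := by
  have hd : ∀ x ∈ Set.Ioi (0:ℝ), HasDerivAt besselEnergy _ x := fun x hx =>
    hasDerivAt_besselEnergy (ne_of_gt hx)
  refine antitoneOn_of_deriv_nonpos (convex_Ioi 0)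
    (fun x hx => (hd x hx).continuousAt.continuousWithinAt)
    (fun x hx => ?_) (fun x hx => ?_) <;> rw [interior_Ioi] at hx
  · exact (hd x hx).differentiableAt.differentiableWithinAt
  · rw [(hd x hx).deriv, neg_nonpos]; positivity

lemma mul_besselJ0_sq_le_besselEnergy {x : ℝ} (hx : 0 < x) :
    x * besselJ0 x ^ 2 ≤ besselEnergy x := by
  have h : besselEnergy x - x * besselJ0 x ^ 2 =
      ((x * besselJ1 x - besselJ0 x / 2) ^ 2 + besselJ0 x ^ 2 / 4) / x := by
    rw [besselEnergy]; field_simp; ring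
  have : 0 ≤ besselEnergy x - x * besselJ0 x ^ 2 := by rw [h]; positivity
  linarith

/-- Truncation error of a series dominated by `B yᵏ / k!²`. -/
lemma abs_sub_sum_le_of_le_pow_div_factorial_sq {c : ℕ → ℝ} {s B y : ℝ} {n : ℕ} (hs : HasSum c s)
    (hB : 0 ≤ B) (hy : 0 ≤ y) (hc : ∀ k, |c k| ≤ B * (y ^ k / (k.factorial : ℝ) ^ 2))
    (hn : 2 * y ≤ (n:ℝ) ^ 2) :
    |s - ∑ k ∈ Finset.range n, c k| ≤ 2 * B * (y ^ n / (n.factorial : ℝ) ^ 2) := by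
  have hdecay : ∀ j : ℕ, y ^ (j + n) / ((j + n).factorial : ℝ) ^ 2 ≤
      y ^ n / (n.factorial : ℝ) ^ 2 * (1 / 2) ^ j := by
    intro j
    induction j with
    | zero => simp
    | succ j ih =>
      have hle : y / ((j + n + 1 : ℕ) : ℝ) ^ 2 ≤ 1 / 2 := by
        rw [div_le_iff₀ (by positivity)]
        push_cast
        nlinarith [(Nat.cast_nonneg j : (0:ℝ) ≤ j), (Nat.cast_nonneg n : (0:ℝ) ≤ n)]
      calc y ^ (j + 1 + n) / ((j + 1 + n).factorial : ℝ) ^ 2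
          = y ^ (j + n) / ((j + n).factorial : ℝ) ^ 2 * (y / ((j + n + 1 : ℕ) : ℝ) ^ 2) := by
            rw [show j + 1 + n = j + n + 1 by ring, Nat.factorial_succ, pow_succ]
            push_cast; field_simp
        _ ≤ y ^ n / (n.factorial : ℝ) ^ 2 * (1 / 2) ^ j * (1 / 2) := by gcongr
        _ = _ := by ring
  have hsum : HasSum (fun j => B * (y ^ n / (n.factorial : ℝ) ^ 2) * (1 / 2) ^ j)
      (B * (y ^ n / (n.factorial : ℝ) ^ 2) * 2) := hasSum_geometric_two.mul_left _
  have h := (hasSum_nat_add_iff' n).2 hs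
  rw [← h.tsum_eq, ← Real.norm_eq_abs]
  refine (tsum_of_norm_bounded hsum fun j => ?_).trans_eq (by ring)
  rw [Real.norm_eq_abs, mul_assoc]
  exact (hc _).trans (mul_le_mul_of_nonneg_left (hdecay j) hB)

lemma besselEnergy_eight_le : besselEnergy 8 ≤ 64 / 100 := by
  have h0 := abs_sub_sum_le_of_le_pow_div_factorial_sq (n := 14) (B := 1) (y := 16)
    (hasSum_besselJ0 8) (by norm_num) (by norm_num)
    (fun k => by
      rw [abs_div, abs_mul, abs_pow, abs_neg, abs_one, one_pow, one_mul, one_mul,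
        abs_of_nonneg (by positivity), abs_of_nonneg (by positivity)]
      norm_num) (by norm_num)
  have h1 := abs_sub_sum_le_of_le_pow_div_factorial_sq (n := 14) (B := 4) (y := 16)
    (hasSum_besselJ1 8) (by norm_num) (by norm_num)
    (fun k => by
      rw [abs_mul, abs_of_pos (by norm_num : (0:ℝ) < 8 / 2), abs_div, abs_mul, abs_pow, abs_neg,
        abs_one, one_pow, one_mul, abs_of_nonneg (by positivity), abs_of_nonneg (by positivity)]
      norm_num
      gcongr
      exact le_mul_of_one_le_right (by positivity) (by linarith [(Nat.cast_nonneg k : (0:ℝ) ≤ k)]))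
    (by norm_num)
  simp only [Finset.sum_range_succ, Finset.sum_range_zero, Nat.factorial] at h0 h1
  norm_num [abs_le] at h0 h1
  have a0 : |besselJ0 8| ≤ 0.1718 := abs_le.2 ⟨by linarith, by linarith⟩
  have b0 : 0.171 ≤ besselJ0 8 := by linarith
  have b1 : 0.234 ≤ besselJ1 8 := by linarith
  have c1 : besselJ1 8 ≤ 0.2348 := by linarith
  rw [abs_le] at a0
  rw [besselEnergy]
  nlinarith

lemma abs_besselJ0_le {x X b : ℝ} (hX : 8 ≤ X) (hx : X ≤ x) (hb : 0 ≤ b)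
    (h : 64 / 100 ≤ b ^ 2 * X) : |besselJ0 x| ≤ b := by
  have h1 := mul_besselJ0_sq_le_besselEnergy (x := x) (by linarith)
  have h2 := antitoneOn_besselEnergy (a := 8) (b := x) (by simp) (by simp; linarith) (by linarith)
  have h3 : X * besselJ0 x ^ 2 ≤ x * besselJ0 x ^ 2 := by gcongr
  refine abs_le_of_sq_le_sq (le_of_mul_le_mul_left ?_ (by linarith : 0 < X)) hb
  linarith [besselEnergy_eight_le]

lemma abs_besselJ0_sub_le (x y : ℝ) : |besselJ0 x - besselJ0 y| ≤ 71 / 100 * |x - y| := by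
  rw [besselJ0, besselJ0, ← circleMean_sub (by fun_prop) (by fun_prop)]
  refine (abs_circleMean_le (by fun_prop)).trans ?_
  have h : ∀ θ, |Real.cos (x * Real.cos θ) - Real.cos (y * Real.cos θ)| ≤
      |x - y| * (7 / 10 * Real.cos θ ^ 2 + 5 / 14) := by
    intro θ
    refine (Real.abs_cos_sub_cos_le _ _).trans ?_
    rw [← sub_mul, abs_mul]
    gcongr
    rw [← sq_abs (Real.cos θ)]
    nlinarith [sq_nonneg (|Real.cos θ| - 5 / 7)]
  refine (circleMean_mono (by fun_prop) (by fun_prop) h).trans ?_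
  rw [circleMean_const_mul, circleMean_add (by fun_prop) (by fun_prop), circleMean_const_mul,
    circleMean_const, circleMean_cos_sq]
  nlinarith [abs_nonneg (x - y)]

lemma besselJ0_zero : besselJ0 0 = 1 := by simp [besselJ0, circleMean_const]

end

noncomputable section

/-- The radial multiplier whose nonnegativity drives the linear programming bound. -/
def bochnerKernel (t : ℝ) : ℝ :=
  0.324 + 1.602 * besselJ0 (1 * t) + besselJ0 (1.96 * t)
    + 0.167 * besselJ0 (√0.0507 * t) + 0.334 * besselJ0 (√1.4407 * t)
    + 0.18 * besselJ0 (√0.12 * t) + 0.36 * besselJ0 (√1.72 * t)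

/-- Application of `f` that makes the kernel normalize the argument to a literal first. -/
def forceNat {α : Type} (n : ℕ) (f : ℕ → α) : α :=
  Nat.rec (f 0) (fun m _ => f m.succ) n

/-- Numerator of the absolute value of the `k`-th Taylor coefficient of
`x ↦ bochnerKernel (80 * √x)`. -/
def coeffNum (k : ℕ) : ℕ :=
  1602 * 160000 ^ k + 1000 * 614656 ^ k + 167 * 8112 ^ k + 334 * 230512 ^ k
    + 180 * 19200 ^ k + 360 * 275200 ^ k + (if k = 0 then 324 else 0)

/-- Denominator of the absolute value of the `k`-th Taylor coefficient of
`x ↦ bochnerKernel (80 * √x)`. -/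
def coeffDen (k : ℕ) : ℕ := 1000 * 100 ^ k * (k.factorial) ^ 2

/-- Even coefficients, rounded down, in units of `2⁻³⁰`. -/
def evenCoeff (j : ℕ) : ℕ := 2 ^ 30 * coeffNum (2 * j) / coeffDen (2 * j)

/-- Odd coefficients, rounded up, in units of `2⁻³⁰`. -/
def oddCoeff (j : ℕ) : ℕ := 2 ^ 30 * coeffNum (2 * j + 1) / coeffDen (2 * j + 1) + 1

/-- Apply `c` to the list `f 0, …, f (n - 1)` prepended to `l`, entries being evaluated. -/
def buildList {α : Type} (f : ℕ → ℕ) (c : List ℕ → α) : ℕ → List ℕ → α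
  | 0, l => c l
  | j + 1, l => forceNat (f j) fun a => buildList f c j (a :: l)

/-- Horner evaluation at `z / 2⁸⁸`, rounded down. -/
def hornerLow (z : ℕ) (l : List ℕ) : ℕ :=
  List.rec 0 (fun a _ h => Nat.add a (Nat.shiftRight (Nat.mul z h) 88)) l

/-- Horner evaluation at `z / 2⁸⁸`, rounded up. -/
def hornerUp (z : ℕ) (l : List ℕ) : ℕ :=
  List.rec 0 (fun a _ h => Nat.succ (Nat.add a (Nat.shiftRight (Nat.mul z h) 88))) l

/-- A lower bound, in units of `2⁻³⁰`, for `bochnerKernel (80 * n / 2²²)`, when positive. -/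
def lowerValue (E O : List ℕ) (n : ℕ) : ℕ :=
  forceNat (n ^ 4) fun z => hornerLow z E - ((n ^ 2 * hornerUp z O) >>> 44 + 2)

/-- March from `n` to `N` with steps justified by a Lipschitz bound. -/
def sweep (E O : List ℕ) (N : ℕ) : ℕ → ℕ → Bool
  | 0, _ => false
  | f + 1, n => Nat.rec (forceNat (n + lowerValue E O n / 66000) (sweep E O N f))
      (fun _ _ => true) (n - N)

/-- The complete verification on `[0, 80]`. -/
def sweepCheck : Bool :=
  buildList evenCoeff (fun E => buildList oddCoeff (fun O => sweep E O (2 ^ 22) 2300 0) 120 []) 120 []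

set_option maxRecDepth 100000 in
lemma sweepCheck_eq_true : sweepCheck = true := by decide +kernel

lemma forceNat_eq {α : Type} (n : ℕ) (f : ℕ → α) : forceNat n f = f n := by
  cases n <;> rfl

lemma buildList_eq {α : Type} (f : ℕ → ℕ) (c : List ℕ → α) (n : ℕ) (l : List ℕ) :
    buildList f c n l = c ((List.range n).map f ++ l) := by
  induction n generalizing l with
  | zero => rfl
  | succ n ih => rw [buildList, forceNat_eq, ih, List.range_succ]; simp

lemma hornerLow_cons (z a : ℕ) (l : List ℕ) :
    hornerLow z (a :: l) = a + z * hornerLow z l / 2 ^ 88 := by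
  rw [← Nat.shiftRight_eq_div_pow]; rfl

lemma hornerUp_cons (z a : ℕ) (l : List ℕ) :
    hornerUp z (a :: l) = a + z * hornerUp z l / 2 ^ 88 + 1 := by
  rw [← Nat.shiftRight_eq_div_pow]; rfl

lemma hornerLow_le (z : ℕ) (f : ℕ → ℕ) (n : ℕ) :
    (hornerLow z ((List.range n).map f) : ℝ) ≤
      ∑ j ∈ Finset.range n, (f j : ℝ) * ((z : ℝ) / 2 ^ 88) ^ j := by
  induction n generalizing f with
  | zero => simp [hornerLow]
  | succ n ih =>
    rw [List.range_succ_eq_map, List.map_cons, List.map_map, hornerLow_cons,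
      Finset.sum_range_succ']
    have h := ih (f ∘ Nat.succ)
    have h2 : ((z * hornerLow z ((List.range n).map (f ∘ Nat.succ)) / 2 ^ 88 : ℕ) : ℝ) ≤
        (z : ℝ) / 2 ^ 88 * ∑ j ∈ Finset.range n, (f (j + 1) : ℝ) * ((z : ℝ) / 2 ^ 88) ^ j := by
      refine Nat.cast_div_le.trans ?_
      rw [Nat.cast_mul, mul_div_right_comm, Nat.cast_pow, Nat.cast_ofNat]
      exact mul_le_mul_of_nonneg_left h (by positivity)
    rw [Finset.mul_sum] at h2
    rw [Nat.cast_add, add_comm, pow_zero, mul_one]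
    gcongr
    refine h2.trans_eq (Finset.sum_congr rfl fun j _ => by ring)

lemma le_hornerUp (z : ℕ) (f : ℕ → ℕ) (n : ℕ) :
    ∑ j ∈ Finset.range n, (f j : ℝ) * ((z : ℝ) / 2 ^ 88) ^ j ≤
      (hornerUp z ((List.range n).map f) : ℝ) := by
  induction n generalizing f with
  | zero => simp
  | succ n ih =>
    rw [List.range_succ_eq_map, List.map_cons, List.map_map, hornerUp_cons,
      Finset.sum_range_succ']
    have h := ih (f ∘ Nat.succ)
    have h2 : (z : ℝ) / 2 ^ 88 * ∑ j ∈ Finset.range n, (f (j + 1) : ℝ) * ((z : ℝ) / 2 ^ 88) ^ j ≤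
        ((z * hornerUp z ((List.range n).map (f ∘ Nat.succ)) / 2 ^ 88 : ℕ) : ℝ) + 1 := by
      have h3 := (Nat.lt_div_mul_add (a := z * hornerUp z ((List.range n).map (f ∘ Nat.succ)))
        (b := 2 ^ 88) (by norm_num)).le
      have h4 : (z * hornerUp z ((List.range n).map (f ∘ Nat.succ)) : ℝ) ≤
        ((z * hornerUp z ((List.range n).map (f ∘ Nat.succ)) / 2 ^ 88 : ℕ) : ℝ) * 2 ^ 88 + 2 ^ 88 :=
        by exact_mod_cast h3
      calc _ ≤ (z : ℝ) / 2 ^ 88 * hornerUp z ((List.range n).map (f ∘ Nat.succ)) := by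
            gcongr
            exact h
        _ = (z * hornerUp z ((List.range n).map (f ∘ Nat.succ)) : ℝ) / 2 ^ 88 := by ring
        _ ≤ _ := by
            rw [div_le_iff₀ (by positivity)]; linarith
    rw [Finset.mul_sum] at h2
    rw [Nat.cast_add, Nat.cast_add, Nat.cast_one]
    rw [pow_zero, mul_one]
    have : ∑ j ∈ Finset.range n, (f (j + 1) : ℝ) * ((z : ℝ) / 2 ^ 88) ^ (j + 1) =
        ∑ j ∈ Finset.range n, (z : ℝ) / 2 ^ 88 * ((f (j + 1) : ℝ) * ((z : ℝ) / 2 ^ 88) ^ j) :=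
      Finset.sum_congr rfl fun j _ => by ring
    rw [this]
    linarith

/-- Taylor coefficients of `x ↦ bochnerKernel (80 * √x)`. -/
def kernelCoeff (k : ℕ) : ℝ := coeffNum k / coeffDen k

lemma kernelCoeff_nonneg (k : ℕ) : 0 ≤ kernelCoeff k := by
  unfold kernelCoeff; positivity

lemma coeffDen_pos (k : ℕ) : 0 < coeffDen k := by
  unfold coeffDen; positivity

lemma evenCoeff_le (j : ℕ) : (evenCoeff j : ℝ) ≤ 2 ^ 30 * kernelCoeff (2 * j) := by
  refine Nat.cast_div_le.trans_eq ?_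
  rw [kernelCoeff, mul_div_assoc']; norm_num

lemma le_oddCoeff (j : ℕ) : 2 ^ 30 * kernelCoeff (2 * j + 1) ≤ oddCoeff j := by
  have h := (Nat.lt_div_mul_add (a := 2 ^ 30 * coeffNum (2 * j + 1))
    (coeffDen_pos (2 * j + 1))).le
  have h2 : (2 ^ 30 * coeffNum (2 * j + 1) : ℝ) ≤ (oddCoeff j : ℝ) * coeffDen (2 * j + 1) := by
    rw [oddCoeff]
    have := (Nat.cast_le (α := ℝ)).2 h
    push_cast at this ⊢
    linarith
  rw [kernelCoeff, mul_div_assoc', div_le_iff₀ (by exact_mod_cast coeffDen_pos _)]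
  exact h2

lemma kernelCoeff_eq (k : ℕ) : kernelCoeff k =
    (if k = 0 then 0.324 else 0) + 1.602 * (1600 ^ k / (k.factorial : ℝ) ^ 2)
    + 6146.56 ^ k / (k.factorial : ℝ) ^ 2
    + 0.167 * (81.12 ^ k / (k.factorial : ℝ) ^ 2) + 0.334 * (2305.12 ^ k / (k.factorial : ℝ) ^ 2)
    + 0.18 * (192 ^ k / (k.factorial : ℝ) ^ 2) + 0.36 * (2752 ^ k / (k.factorial : ℝ) ^ 2) := by
  have h (a b : ℝ) (hb : b * 100 = a) : b ^ k = a ^ k / 100 ^ k := by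
    rw [← hb, mul_pow, mul_div_cancel_right₀ _ (by positivity)]
  rw [h 160000 1600 (by norm_num), h 614656 6146.56 (by norm_num), h 8112 81.12 (by norm_num),
    h 230512 2305.12 (by norm_num), h 19200 192 (by norm_num), h 275200 2752 (by norm_num),
    kernelCoeff, coeffNum, coeffDen]
  rcases eq_or_ne k 0 with rfl | hk
  · norm_num
  · simp only [hk, if_false]
    push_cast
    field_simp
    ring

lemma kernelCoeff_le (k : ℕ) : kernelCoeff k ≤ 4 * (6146.56 ^ k / (k.factorial : ℝ) ^ 2) := by
  rw [kernelCoeff_eq]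
  have h (b : ℝ) (h0 : 0 ≤ b) (hb : b ≤ 6146.56) :
      b ^ k / (k.factorial : ℝ) ^ 2 ≤ 6146.56 ^ k / (k.factorial : ℝ) ^ 2 := by gcongr
  have h1 : (if k = 0 then 0.324 else 0 : ℝ) ≤ 0.324 * (6146.56 ^ k / (k.factorial : ℝ) ^ 2) := by
    split_ifs with hk
    · subst hk; norm_num
    · positivity
  have h0 : 0 ≤ (6146.56 : ℝ) ^ k / (k.factorial : ℝ) ^ 2 := by positivity
  linarith [h 1600 (by norm_num) (by norm_num), h 81.12 (by norm_num) (by norm_num),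
    h 2305.12 (by norm_num) (by norm_num), h 192 (by norm_num) (by norm_num),
    h 2752 (by norm_num) (by norm_num)]

lemma hasSum_bochnerKernel (x : ℝ) :
    HasSum (fun k => (-1) ^ k * kernelCoeff k * (x ^ 2) ^ k) (bochnerKernel (80 * x)) := by
  have h (r b : ℝ) (hb : r ^ 2 * 1600 = b) :
      HasSum (fun k : ℕ => (-1) ^ k * (b ^ k / (k.factorial : ℝ) ^ 2) * (x ^ 2) ^ k)
        (besselJ0 (r * (80 * x))) := by
    refine (hasSum_besselJ0 _).congr_fun fun k => ?_
    rw [show (r * (80 * x)) ^ 2 / 4 = b * x ^ 2 by rw [← hb]; ring, mul_pow]; ring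
  have h0 : HasSum (fun k : ℕ => if k = 0 then (0.324 : ℝ) else 0) 0.324 := by
    simpa using hasSum_ite_eq (0 : ℕ) (0.324 : ℝ)
  refine ((((((h0.add ((h 1 1600 (by norm_num)).mul_left 1.602)).add
    (h 1.96 6146.56 (by norm_num))).add
    ((h (√0.0507) 81.12 (by rw [Real.sq_sqrt] <;> norm_num)).mul_left 0.167)).add
    ((h (√1.4407) 2305.12 (by rw [Real.sq_sqrt] <;> norm_num)).mul_left 0.334)).add
    ((h (√0.12) 192 (by rw [Real.sq_sqrt] <;> norm_num)).mul_left 0.18)).add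
    ((h (√1.72) 2752 (by rw [Real.sq_sqrt] <;> norm_num)).mul_left 0.36)).congr_fun fun k => ?_
  rw [kernelCoeff_eq]
  rcases eq_or_ne k 0 with rfl | hk
  · norm_num
  · simp only [hk, if_false]
    ring

lemma truncation_error_le :
    2 * 4 * ((6146.56:ℝ) ^ 240 / ((240).factorial : ℝ) ^ 2) ≤ 1 / 2 ^ 30 := by
  have h : 8 * 614656 ^ 240 * 2 ^ 30 ≤ 100 ^ 240 * (240).factorial ^ 2 := by decide +kernel
  have h2 : (8 * 614656 ^ 240 * 2 ^ 30 : ℝ) ≤ 100 ^ 240 * ((240).factorial : ℝ) ^ 2 := by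
    exact_mod_cast h
  rw [show (6146.56:ℝ) = 614656 / 100 by norm_num, div_pow, div_div, ← mul_div_assoc,
    div_le_div_iff₀ (by positivity) (by positivity)]
  linarith

lemma lowerValue_sub_le {x : ℝ} (hx0 : 0 ≤ x) (hx1 : x ≤ 1) :
    2 ^ 30 * (∑ j ∈ Finset.range 120, kernelCoeff (2 * j) * (x ^ 4) ^ j
      - x ^ 2 * ∑ j ∈ Finset.range 120, kernelCoeff (2 * j + 1) * (x ^ 4) ^ j) - 1 ≤
      2 ^ 30 * bochnerKernel (80 * x) := by
  have hx2 : x ^ 2 ≤ 1 := pow_le_one₀ hx0 hx1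
  have h := abs_sub_sum_le_of_le_pow_div_factorial_sq (n := 240) (B := 4) (y := 6146.56)
    (hasSum_bochnerKernel x) (by norm_num) (by norm_num)
    (fun k => by
      rw [abs_mul, abs_mul, abs_pow, abs_neg, abs_one, one_pow, one_mul,
        abs_of_nonneg (kernelCoeff_nonneg k), abs_of_nonneg (by positivity)]
      exact (mul_le_of_le_one_right (kernelCoeff_nonneg k)
        (pow_le_one₀ (by positivity) hx2)).trans (kernelCoeff_le k)) (by norm_num)
  have hsplit : ∀ m : ℕ, ∑ k ∈ Finset.range (2 * m), (-1) ^ k * kernelCoeff k * (x ^ 2) ^ k =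
      ∑ j ∈ Finset.range m, kernelCoeff (2 * j) * (x ^ 4) ^ j
      - x ^ 2 * ∑ j ∈ Finset.range m, kernelCoeff (2 * j + 1) * (x ^ 4) ^ j := by
    intro m
    induction m with
    | zero => simp
    | succ m ih =>
      rw [show 2 * (m + 1) = 2 * m + 1 + 1 by ring, Finset.sum_range_succ, Finset.sum_range_succ,
        ih, Finset.sum_range_succ, Finset.sum_range_succ]
      have : (-1 : ℝ) ^ (2 * m) = 1 := by simp
      rw [pow_succ (-1 : ℝ), this]
      ring
  rw [hsplit 120] at h
  have h2 := (abs_le.1 (h.trans truncation_error_le)).1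
  linarith

/-- The even coefficients used in `sweepCheck`. -/
abbrev evenList : List ℕ := (List.range 120).map evenCoeff

/-- The odd coefficients used in `sweepCheck`. -/
abbrev oddList : List ℕ := (List.range 120).map oddCoeff

lemma lowerValue_le {n : ℕ} (hn : n ≤ 2 ^ 22) (hpos : 0 < lowerValue evenList oddList n) :
    (lowerValue evenList oddList n : ℝ) ≤ 2 ^ 30 * bochnerKernel (80 * (n / 2 ^ 22)) := by
  rw [lowerValue, forceNat_eq] at hpos ⊢
  rw [Nat.cast_sub (by omega)]
  have hx1 : (n / 2 ^ 22 : ℝ) ≤ 1 := by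
    rw [div_le_one (by positivity)]; exact_mod_cast hn
  have key := lowerValue_sub_le (x := n / 2 ^ 22) (by positivity) hx1
  set x : ℝ := n / 2 ^ 22 with hx
  have hz : ((n ^ 4 : ℕ) : ℝ) / 2 ^ 88 = x ^ 4 := by
    rw [hx, div_pow, ← pow_mul]; push_cast; rfl
  have hE : (hornerLow (n ^ 4) evenList : ℝ) ≤
      2 ^ 30 * ∑ j ∈ Finset.range 120, kernelCoeff (2 * j) * (x ^ 4) ^ j := by
    refine (hornerLow_le _ _ _).trans ?_
    rw [hz, Finset.mul_sum]
    refine Finset.sum_le_sum fun j _ => ?_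
    rw [← mul_assoc]
    gcongr
    exact evenCoeff_le j
  have hO : 2 ^ 30 * ∑ j ∈ Finset.range 120, kernelCoeff (2 * j + 1) * (x ^ 4) ^ j ≤
      (hornerUp (n ^ 4) oddList : ℝ) := by
    refine le_trans ?_ (le_hornerUp _ _ _)
    rw [hz, Finset.mul_sum]
    refine Finset.sum_le_sum fun j _ => ?_
    rw [← mul_assoc]
    gcongr
    exact le_oddCoeff j
  have hS : x ^ 2 * (hornerUp (n ^ 4) oddList : ℝ) ≤
      ((n ^ 2 * hornerUp (n ^ 4) oddList) >>> 44 : ℕ) + 1 := by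
    rw [Nat.shiftRight_eq_div_pow]
    have h3 := (Nat.lt_div_mul_add (a := n ^ 2 * hornerUp (n ^ 4) oddList)
      (b := 2 ^ 44) (by norm_num)).le
    have h4 : (n ^ 2 * hornerUp (n ^ 4) oddList : ℝ) ≤
      ((n ^ 2 * hornerUp (n ^ 4) oddList / 2 ^ 44 : ℕ) : ℝ) * 2 ^ 44 + 2 ^ 44 := by
      exact_mod_cast h3
    rw [hx, div_pow, ← pow_mul, div_mul_eq_mul_div, div_le_iff₀ (by positivity)]
    linarith
  have hO2 := mul_le_mul_of_nonneg_left hO (sq_nonneg x)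
  push_cast
  linarith

lemma abs_bochnerKernel_sub_le (x y : ℝ) :
    |bochnerKernel (80 * x) - bochnerKernel (80 * y)| ≤ 66000 / 256 * |x - y| := by
  have h (w r R : ℝ) (hw : 0 ≤ w) (hr : 0 ≤ r) (hR : r ≤ R) :
      |w * besselJ0 (r * (80 * x)) - w * besselJ0 (r * (80 * y))| ≤ w * R * (56.8 * |x - y|) := by
    rw [← mul_sub, abs_mul, abs_of_nonneg hw, mul_assoc]
    gcongr
    refine (abs_besselJ0_sub_le _ _).trans ?_
    rw [← mul_sub, ← mul_sub, abs_mul, abs_mul, abs_of_nonneg hr]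
    norm_num
    nlinarith [mul_nonneg (sub_nonneg.2 hR) (abs_nonneg (x - y))]
  have s1 := h 1.602 1 1 (by norm_num) (by norm_num) le_rfl
  have s2 := h 1 1.96 1.96 (by norm_num) (by norm_num) le_rfl
  have s3 := h 0.167 (√0.0507) 0.2252 (by norm_num) (by positivity)
    (Real.sqrt_le_iff.2 (by norm_num))
  have s4 := h 0.334 (√1.4407) 1.2003 (by norm_num) (by positivity)
    (Real.sqrt_le_iff.2 (by norm_num))
  have s5 := h 0.18 (√0.12) 0.3465 (by norm_num) (by positivity)
    (Real.sqrt_le_iff.2 (by norm_num))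
  have s6 := h 0.36 (√1.72) 1.3115 (by norm_num) (by positivity)
    (Real.sqrt_le_iff.2 (by norm_num))
  rw [abs_le] at s1 s2 s3 s4 s5 s6 ⊢
  have := abs_nonneg (x - y)
  simp only [bochnerKernel]
  constructor <;> linarith

lemma sweep_succ (E O : List ℕ) (f : ℕ) {n N : ℕ} (hn : n ≤ N) :
    sweep E O N (f + 1) n = sweep E O N f (n + lowerValue E O n / 66000) := by
  rw [sweep, Nat.sub_eq_zero_of_le hn, forceNat_eq]
  rfl

lemma sweep_sound {E O : List ℕ} {fuel n : ℕ} (h : sweep E O (2 ^ 22) fuel n = true)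
    (hlow : ∀ n : ℕ, n ≤ 2 ^ 22 → 0 < lowerValue E O n →
      (lowerValue E O n : ℝ) ≤ 2 ^ 30 * bochnerKernel (80 * (n / 2 ^ 22)))
    (hn : ∀ x : ℝ, 0 ≤ x → x ≤ n / 2 ^ 22 → 0 ≤ bochnerKernel (80 * x)) :
    ∀ x : ℝ, 0 ≤ x → x ≤ 1 → 0 ≤ bochnerKernel (80 * x) := by
  induction fuel generalizing n with
  | zero => simp [sweep] at h
  | succ f ih =>
    rcases Nat.lt_or_ge (2 ^ 22) n with hlt | hle
    · intro x h0 h1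
      refine hn x h0 (h1.trans ?_)
      rw [le_div_iff₀ (by positivity), one_mul]
      exact_mod_cast hlt.le
    · rw [sweep_succ _ _ _ hle] at h
      refine ih h fun x h0 h1 => ?_
      rcases le_total x (n / 2 ^ 22) with hx | hx
      · exact hn x h0 hx
      rcases Nat.eq_zero_or_pos (lowerValue E O n) with hv | hv
      · rw [hv] at h1
        exact hn x h0 (by simpa using h1)
      · have hb := hlow n hle hv
        have hl := (abs_le.1 (abs_bochnerKernel_sub_le x (n / 2 ^ 22))).1
        rw [abs_of_nonneg (sub_nonneg.2 hx)] at hl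
        have hd : ((lowerValue E O n / 66000 : ℕ) : ℝ) ≤ (lowerValue E O n : ℝ) / 66000 := by
          exact_mod_cast Nat.cast_div_le
        rw [le_div_iff₀ (by positivity), Nat.cast_add] at h1
        have hxn : x - n / 2 ^ 22 ≤ (lowerValue E O n : ℝ) / 66000 / 2 ^ 22 := by
          rw [le_div_iff₀ (by positivity), sub_mul, div_mul_cancel₀ _ (by positivity)]
          linarith
        linarith

lemma bochnerKernel_zero : bochnerKernel 0 = 3.967 := by
  simp only [bochnerKernel, mul_zero, besselJ0_zero]; norm_num

lemma bochnerKernel_nonneg {t : ℝ} (ht : 0 ≤ t) : 0 ≤ bochnerKernel t := by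
  rcases le_total t 80 with h | h
  · have hs := sweepCheck_eq_true
    rw [sweepCheck, buildList_eq, buildList_eq, List.append_nil, List.append_nil] at hs
    have := sweep_sound hs (fun n => lowerValue_le) (fun x h0 h1 => by
      have : x = 0 := le_antisymm (by simpa using h1) h0
      rw [this, mul_zero, bochnerKernel_zero]; norm_num) (t / 80) (by positivity) (by linarith)
    rwa [mul_div_cancel₀ _ (by norm_num)] at this
  · have hJ (r R b : ℝ) (hR0 : 0 ≤ R) (hR : R ≤ r) (h8 : 8 ≤ R * 80) (hb : 0 ≤ b)
        (hb2 : 64 / 100 ≤ b ^ 2 * (R * 80)) : -b ≤ besselJ0 (r * t) :=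
      (abs_le.1 (abs_besselJ0_le h8 (mul_le_mul hR h (by norm_num) (hR0.trans hR)) hb hb2)).1
    have s1 := hJ 1 1 0.08945 (by norm_num) le_rfl (by norm_num) (by norm_num) (by norm_num)
    have s2 := hJ 1.96 1.96 0.0639 (by norm_num) le_rfl (by norm_num) (by norm_num) (by norm_num)
    have s3 := hJ (√0.0507) 0.225 0.1886 (by norm_num) (Real.le_sqrt_of_sq_le (by norm_num))
      (by norm_num) (by norm_num) (by norm_num)
    have s4 := hJ (√1.4407) 1.2 0.0817 (by norm_num) (Real.le_sqrt_of_sq_le (by norm_num))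
      (by norm_num) (by norm_num) (by norm_num)
    have s5 := hJ (√0.12) 0.346 0.1521 (by norm_num) (Real.le_sqrt_of_sq_le (by norm_num))
      (by norm_num) (by norm_num) (by norm_num)
    have s6 := hJ (√1.72) 1.311 0.0782 (by norm_num) (Real.le_sqrt_of_sq_le (by norm_num))
      (by norm_num) (by norm_num) (by norm_num)
    rw [bochnerKernel]
    linarith

end

noncomputable section

open scoped ComplexConjugate

section TorusFourier

variable {K : ℝ}

/-- The Haar probability measure on the two-dimensional torus. -/
def torusHaar (K : ℝ) [Fact (0 < K)] : Measure (AddCircle K × AddCircle K) :=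
  (AddCircle.haarAddCircle).prod AddCircle.haarAddCircle

instance [Fact (0 < K)] : IsProbabilityMeasure (torusHaar K) := by unfold torusHaar; infer_instance

instance [Fact (0 < K)] : (torusHaar K).IsAddHaarMeasure := by unfold torusHaar; infer_instance

instance [Fact (0 < K)] : (torusHaar K).WeaklyRegular := by unfold torusHaar; infer_instance

/-- Characters of the two-dimensional torus. -/
def torusFourier (n : ℤ × ℤ) : C(AddCircle K × AddCircle K, ℂ) where
  toFun x := fourier n.1 x.1 * fourier n.2 x.2
  continuous_toFun := by fun_prop

lemma torusFourier_apply (n : ℤ × ℤ) (x : AddCircle K × AddCircle K) :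
    torusFourier n x = fourier n.1 x.1 * fourier n.2 x.2 := rfl

lemma torusFourier_neg (n : ℤ × ℤ) (x : AddCircle K × AddCircle K) :
    torusFourier (-n) x = conj (torusFourier n x) := by
  simp only [torusFourier_apply, Prod.fst_neg, Prod.snd_neg, fourier_neg, map_mul]

lemma torusFourier_add (m n : ℤ × ℤ) (x : AddCircle K × AddCircle K) :
    torusFourier (m + n) x = torusFourier m x * torusFourier n x := by
  simp only [torusFourier_apply, Prod.fst_add, Prod.snd_add, fourier_add]; ring

lemma torusFourier_zero (x : AddCircle K × AddCircle K) : torusFourier 0 x = 1 := by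
  simp [torusFourier_apply]

lemma torusFourier_apply_add (n : ℤ × ℤ) (x y : AddCircle K × AddCircle K) :
    torusFourier n (x + y) = torusFourier n x * torusFourier n y := by
  simp only [torusFourier_apply, Prod.fst_add, Prod.snd_add, fourier_apply, smul_add,
    AddCircle.toCircle_add, Circle.coe_mul]
  ring

lemma autocorr_zero (A : Set (AddCircle K × AddCircle K)) : autocorr K A 0 = density K A := by
  simp [autocorr]

/-- The projection of the plane to the torus. -/
def torusMk (K : ℝ) (p : ℝ × ℝ) : AddCircle K × AddCircle K := (p.1, p.2)

lemma continuous_torusMk : Continuous (torusMk K) := by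
  unfold torusMk
  exact (AddCircle.continuous_mk' K |>.comp continuous_fst).prodMk
    (AddCircle.continuous_mk' K |>.comp continuous_snd)

lemma torusMk_sub (p q : ℝ × ℝ) : torusMk K (p - q) = torusMk K p - torusMk K q := by
  simp [torusMk]

/-- The rotation by `θ` of the vector `p`, projected to the torus. -/
def torusRotate (K : ℝ) (p : ℝ × ℝ) (θ : ℝ) : AddCircle K × AddCircle K :=
  torusMk K (p.1 * Real.cos θ - p.2 * Real.sin θ, p.1 * Real.sin θ + p.2 * Real.cos θ)

lemma torusRotate_sub (p q : ℝ × ℝ) (θ : ℝ) :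
    torusRotate K p θ - torusRotate K q θ = torusRotate K (p - q) θ := by
  rw [torusRotate, torusRotate, ← torusMk_sub, torusRotate]
  congr 1
  ext <;> simp <;> ring

lemma torusFourier_torusMk_re (n : ℤ × ℤ) (p : ℝ × ℝ) :
    (torusFourier n (torusMk K p)).re = Real.cos (2 * Real.pi / K * (n.1 * p.1 + n.2 * p.2)) := by
  rw [torusFourier_apply, torusMk, fourier_coe_apply, fourier_coe_apply, ← Complex.exp_add,
    ← Complex.exp_ofReal_mul_I_re]
  congr 2
  push_cast
  ring

variable [hK : Fact (0 < K)]

/-- The star subalgebra of `C(𝕋², ℂ)` generated by the characters. -/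
def torusFourierSubalgebra (K : ℝ) [Fact (0 < K)] :
    StarSubalgebra ℂ C(AddCircle K × AddCircle K, ℂ) where
  toSubalgebra := Algebra.adjoin ℂ (Set.range torusFourier)
  star_mem' := by
    change Algebra.adjoin ℂ (Set.range torusFourier) ≤
      star (Algebra.adjoin ℂ (Set.range torusFourier))
    refine Algebra.adjoin_le ?_
    rintro _ ⟨n, rfl⟩
    refine Algebra.subset_adjoin ⟨-n, ?_⟩
    ext1 x
    simp only [torusFourier_neg, starRingEnd_apply, ContinuousMap.star_apply]

lemma torusFourierSubalgebra_coe :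
    (torusFourierSubalgebra K).toSubalgebra.toSubmodule =
      Submodule.span ℂ (Set.range torusFourier) := by
  apply Algebra.adjoin_eq_span_of_subset
  refine .trans (fun x ↦ Submonoid.closure_induction (fun _ ↦ id) ⟨0, ?_⟩ ?_) Submodule.subset_span
  · ext z
    simp only [torusFourier_zero, ContinuousMap.one_apply]
  · rintro _ _ _ _ ⟨m, rfl⟩ ⟨n, rfl⟩
    refine ⟨m + n, ?_⟩
    ext z
    simp only [torusFourier_add, ContinuousMap.mul_apply]

lemma torusFourierSubalgebra_separatesPoints : (torusFourierSubalgebra K).SeparatesPoints := by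
  intro x y hxy
  rw [Ne, Prod.ext_iff, not_and_or] at hxy
  rcases hxy with h | h
  · refine ⟨_, ⟨torusFourier (1, 0), Algebra.subset_adjoin ⟨(1, 0), rfl⟩, rfl⟩, ?_⟩
    simp only [torusFourier_apply, fourier_one, fourier_zero, mul_one, ne_eq, Circle.coe_inj]
    exact fun h' => h (AddCircle.injective_toCircle hK.out.ne' h')
  · refine ⟨_, ⟨torusFourier (0, 1), Algebra.subset_adjoin ⟨(0, 1), rfl⟩, rfl⟩, ?_⟩
    simp only [torusFourier_apply, fourier_one, fourier_zero, one_mul, ne_eq, Circle.coe_inj]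
    exact fun h' => h (AddCircle.injective_toCircle hK.out.ne' h')

lemma span_torusFourier_closure_eq_top :
    (Submodule.span ℂ (Set.range (torusFourier (K := K)))).topologicalClosure = ⊤ := by
  rw [← torusFourierSubalgebra_coe]
  exact congr_arg (Subalgebra.toSubmodule <| StarSubalgebra.toSubalgebra ·)
    (ContinuousMap.starSubalgebra_topologicalClosure_eq_top_of_separatesPoints _
      torusFourierSubalgebra_separatesPoints)

/-- Characters of the torus as elements of `L²`. -/
def torusFourierLp (n : ℤ × ℤ) : Lp ℂ 2 (torusHaar K) :=
  ContinuousMap.toLp (E := ℂ) 2 (torusHaar K) ℂ (torusFourier n)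

lemma span_torusFourierLp_closure_eq_top :
    (Submodule.span ℂ (Set.range (torusFourierLp (K := K)))).topologicalClosure = ⊤ := by
  simpa only [Submodule.map_span, ContinuousLinearMap.coe_coe, ← Set.range_comp,
    Function.comp_def] using!
    (ContinuousMap.toLp_denseRange ℂ (torusHaar K) ℂ (by simp)).topologicalClosure_map_submodule
      span_torusFourier_closure_eq_top

lemma integral_fourier (n : ℤ) :
    ∫ x : AddCircle K, fourier n x ∂AddCircle.haarAddCircle = if n = 0 then 1 else 0 := by
  have := (orthonormal_iff_ite.mp (orthonormal_fourier (T := K))) 0 n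
  simp only [ContinuousMap.inner_toLp] at this
  simpa [eq_comm] using this

lemma integral_torusFourier (n : ℤ × ℤ) :
    ∫ x, torusFourier n x ∂torusHaar K = if n = 0 then 1 else 0 := by
  simp only [torusFourier_apply, torusHaar]
  rw [integral_prod_mul (fun x => fourier n.1 x) (fun x => fourier n.2 x), integral_fourier,
    integral_fourier]
  rcases n with ⟨a, b⟩
  by_cases ha : a = 0 <;> by_cases hb : b = 0 <;> simp [ha, hb, Prod.ext_iff]

lemma orthonormal_torusFourierLp : Orthonormal ℂ (torusFourierLp (K := K)) := by
  rw [orthonormal_iff_ite]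
  intro m n
  simp only [torusFourierLp, ContinuousMap.inner_toLp, ← torusFourier_neg, ← torusFourier_add,
    integral_torusFourier]
  simp only [add_neg_eq_zero, eq_comm]

/-- The Hilbert basis of characters of the torus. -/
def torusFourierBasis : HilbertBasis (ℤ × ℤ) ℂ (Lp ℂ 2 (torusHaar K)) :=
  HilbertBasis.mk orthonormal_torusFourierLp span_torusFourierLp_closure_eq_top.ge

/-- Fourier coefficients of the indicator function of a set. -/
def setCoeff (A : Set (AddCircle K × AddCircle K)) (n : ℤ × ℤ) : ℂ :=
  ∫ x in A, conj (torusFourier n x) ∂torusHaar K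

lemma inner_torusFourierBasis_indicator {A : Set (AddCircle K × AddCircle K)}
    (hA : MeasurableSet A) (n : ℤ × ℤ) :
    inner ℂ (torusFourierBasis n) (indicatorConstLp 2 hA (measure_ne_top (torusHaar K) A) (1:ℂ)) =
      setCoeff A n := by
  rw [← inner_conj_symm, L2.inner_indicatorConstLp_one, ← integral_conj, setCoeff]
  refine setIntegral_congr_ae hA ?_
  have : torusFourierBasis (K := K) n = torusFourierLp n := by
    rw [torusFourierBasis, HilbertBasis.coe_mk]
  rw [this]
  filter_upwards [ContinuousMap.coeFn_toLp (p := 2) (𝕜 := ℂ) (torusHaar K) (torusFourier n)]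
    with x hx _
  rw [torusFourierLp, hx]

lemma setCoeff_translate {A : Set (AddCircle K × AddCircle K)} (hA : MeasurableSet A)
    (x : AddCircle K × AddCircle K) (n : ℤ × ℤ) :
    setCoeff ((fun y => y + x) ⁻¹' A) n = torusFourier n x * setCoeff A n := by
  rw [setCoeff, setCoeff, ← integral_indicator hA, ← integral_indicator (hA.preimage (by fun_prop)),
    ← integral_add_right_eq_self (μ := torusHaar K) (A.indicator _) x, ← integral_const_mul]
  congr 1; ext y
  by_cases hy : y + x ∈ A
  · rw [Set.indicator_of_mem (by exact hy), Set.indicator_of_mem hy, torusFourier_apply_add,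
      map_mul, mul_comm, mul_assoc, ← torusFourier_neg n x, ← torusFourier_add, neg_add_cancel,
      torusFourier_zero, mul_one]
  · rw [Set.indicator_of_notMem (by exact hy), Set.indicator_of_notMem hy, mul_zero]

lemma density_eq (A : Set (AddCircle K × AddCircle K)) :
    density K A = (torusHaar K).real A := by
  have h0 := hK.out
  rw [density, torusVolume, dif_pos h0, Measure.real, torusHaar, Measure.volume_eq_prod,
    AddCircle.volume_eq_smul_haarAddCircle, Measure.prod_smul_left, Measure.prod_smul_right]
  simp only [Measure.smul_apply, smul_eq_mul, ENNReal.toReal_mul, ENNReal.toReal_ofReal h0.le]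
  field_simp

lemma hasSum_autocorr {A : Set (AddCircle K × AddCircle K)} (hA : MeasurableSet A)
    (x : AddCircle K × AddCircle K) :
    HasSum (fun n => ‖setCoeff A n‖ ^ 2 * (torusFourier n x).re) (autocorr K A x) := by
  have hx : MeasurableSet ((fun y => y + x) ⁻¹' A) := hA.preimage (by fun_prop)
  have := (torusFourierBasis (K := K)).hasSum_inner_mul_inner
    (indicatorConstLp 2 hA (measure_ne_top (torusHaar K) _) (1:ℂ))
    (indicatorConstLp 2 hx (measure_ne_top (torusHaar K) _) (1:ℂ))
  rw [L2.inner_indicatorConstLp_indicatorConstLp] at this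
  have hre := Complex.hasSum_re this
  simp only [inner_torusFourierBasis_indicator, setCoeff_translate hA, ← inner_conj_symm
    (indicatorConstLp _ _ _ _) (torusFourierBasis _)] at hre
  rw [autocorr, density_eq]
  convert hre using 1
  · ext n
    rw [mul_left_comm, Complex.conj_mul', mul_comm, ← Complex.ofReal_pow, Complex.re_mul_ofReal]
  · simp

lemma hasSum_sq_setCoeff {A : Set (AddCircle K × AddCircle K)} (hA : MeasurableSet A) :
    HasSum (fun n => ‖setCoeff A n‖ ^ 2) (density K A) := by
  have := hasSum_autocorr hA 0
  rw [autocorr_zero] at this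
  simpa [torusFourier_apply] using this

lemma setCoeff_zero (A : Set (AddCircle K × AddCircle K)) : setCoeff A 0 = density K A := by
  simp [setCoeff, torusFourier_zero, density_eq]

lemma continuous_autocorr {A : Set (AddCircle K × AddCircle K)} (hA : MeasurableSet A) :
    Continuous (autocorr K A) := by
  have h : autocorr K A = fun x => ∑' n, ‖setCoeff A n‖ ^ 2 * (torusFourier n x).re :=
    funext fun x => (hasSum_autocorr hA x).tsum_eq.symm
  rw [h]
  refine continuous_tsum (fun n => by fun_prop) (hasSum_sq_setCoeff hA).summable fun n x => ?_
  rw [norm_mul, Real.norm_of_nonneg (by positivity)]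
  refine mul_le_of_le_one_right (by positivity) ((Complex.abs_re_le_norm _).trans ?_)
  simp only [torusFourier_apply, fourier_apply, norm_mul, Circle.norm_coe, mul_one, le_refl]

end TorusFourier

lemma circleMean_add_right {f : ℝ → ℝ} (hf : Function.Periodic f (2 * Real.pi)) (φ : ℝ) :
    circleMean (fun θ => f (θ + φ)) = circleMean f := by
  rw [circleMean, intervalIntegral.integral_comp_add_right, circleMean, zero_add, add_comm _ φ,
    hf.intervalIntegral_add_eq φ 0, zero_add]

/-- Averages over circles do not depend on the direction of the starting point. -/
lemma circleMean_rotate (F : ℝ × ℝ → ℝ) (a b : ℝ) :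
    circleMean (fun θ => F (a * Real.cos θ - b * Real.sin θ, a * Real.sin θ + b * Real.cos θ)) =
      circleMean fun θ => F (√(a ^ 2 + b ^ 2) * Real.cos θ, √(a ^ 2 + b ^ 2) * Real.sin θ) := by
  have ha : a = √(a ^ 2 + b ^ 2) * Real.cos (Complex.arg ⟨a, b⟩) := by
    have := Complex.norm_mul_cos_arg ⟨a, b⟩
    rwa [Complex.norm_eq_sqrt_sq_add_sq, eq_comm] at this
  have hb : b = √(a ^ 2 + b ^ 2) * Real.sin (Complex.arg ⟨a, b⟩) := by
    have := Complex.norm_mul_sin_arg ⟨a, b⟩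
    rwa [Complex.norm_eq_sqrt_sq_add_sq, eq_comm] at this
  rw [← circleMean_add_right (f := fun θ => F (√(a ^ 2 + b ^ 2) * Real.cos θ,
    √(a ^ 2 + b ^ 2) * Real.sin θ)) (fun θ => by simp) (Complex.arg ⟨a, b⟩)]
  congr 1; ext θ
  rw [Real.cos_add, Real.sin_add]
  congr 2
  · linear_combination Real.cos θ * ha - Real.sin θ * hb
  · linear_combination Real.sin θ * ha + Real.cos θ * hb

lemma circleMean_cos_add (a b : ℝ) :
    circleMean (fun θ => Real.cos (a * Real.cos θ + b * Real.sin θ)) =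
      besselJ0 (√(a ^ 2 + b ^ 2)) := by
  have := circleMean_rotate (fun p => Real.cos p.1) a (-b)
  simpa [besselJ0] using this

section PairCorrelation

variable {K : ℝ} {A : Set (AddCircle K × AddCircle K)}

lemma circleMean_autocorr (a b : ℝ) :
    circleMean (fun θ => autocorr K A (torusMk K
      (a * Real.cos θ - b * Real.sin θ, a * Real.sin θ + b * Real.cos θ))) =
      paircorr K A (√(a ^ 2 + b ^ 2)) :=
  circleMean_rotate (fun p => autocorr K A (torusMk K p)) a b

variable [hK : Fact (0 < K)]

/-- The length of the frequency vector `2πn / K`. -/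
def frequency (K : ℝ) (n : ℤ × ℤ) : ℝ := 2 * Real.pi / K * √((n.1:ℝ) ^ 2 + (n.2:ℝ) ^ 2)

lemma hasSum_paircorr (hA : MeasurableSet A) {r : ℝ} (hr : 0 ≤ r) :
    HasSum (fun n => ‖setCoeff A n‖ ^ 2 * besselJ0 (r * frequency K n)) (paircorr K A r) := by
  have key := intervalIntegral.hasSum_integral_of_dominated_convergence (μ := volume)
    (a := 0) (b := 2 * Real.pi)
    (F := fun n θ => ‖setCoeff A n‖ ^ 2 *
      (torusFourier n (torusMk K (r * Real.cos θ, r * Real.sin θ))).re)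
    (f := fun θ => autocorr K A (torusMk K (r * Real.cos θ, r * Real.sin θ)))
    (fun n _ => ‖setCoeff A n‖ ^ 2)
    (fun n => Continuous.aestronglyMeasurable (by
      simp only [torusFourier_torusMk_re]; fun_prop))
    (fun n => .of_forall fun θ _ => by
      rw [norm_mul, Real.norm_of_nonneg (by positivity), torusFourier_torusMk_re]
      exact mul_le_of_le_one_right (by positivity) (Real.abs_cos_le_one _))
    (.of_forall fun _ _ => (hasSum_sq_setCoeff hA).summable) (by simp)
    (.of_forall fun θ _ => hasSum_autocorr hA _)
  have := key.mul_left (1 / (2 * Real.pi))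
  refine this.congr_fun fun n => ?_
  have hK0 := hK.out
  have hcos := circleMean_cos_add (2 * Real.pi / K * (n.1 * r)) (2 * Real.pi / K * (n.2 * r))
  have hsq : √((2 * Real.pi / K * (n.1 * r)) ^ 2 + (2 * Real.pi / K * (n.2 * r)) ^ 2) =
      r * frequency K n := by
    rw [show (2 * Real.pi / K * (n.1 * r)) ^ 2 + (2 * Real.pi / K * (n.2 * r)) ^ 2 =
      (r * (2 * Real.pi / K)) ^ 2 * ((n.1:ℝ) ^ 2 + (n.2:ℝ) ^ 2) by ring,
      Real.sqrt_mul (by positivity), Real.sqrt_sq (by positivity), frequency, mul_assoc]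
  rw [hsq] at hcos
  rw [← hcos, ← circleMean_const_mul, circleMean]
  congr 2; ext θ
  rw [torusFourier_torusMk_re]
  congr 2; ring

/-- The positive definiteness inequality for the autocorrelation of a set. -/
lemma sq_density_le_sum_paircorr (hA : MeasurableSet A) :
    3.967 * density K A ^ 2 ≤ 0.324 * density K A + 1.602 * paircorr K A 1 + paircorr K A 1.96
      + 0.167 * paircorr K A (√0.0507) + 0.334 * paircorr K A (√1.4407)
      + 0.18 * paircorr K A (√0.12) + 0.36 * paircorr K A (√1.72) := by
  have hsum : HasSum (fun n => ‖setCoeff A n‖ ^ 2 * bochnerKernel (frequency K n)) _ :=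
    (((((((hasSum_sq_setCoeff hA).mul_left 0.324).add
      ((hasSum_paircorr hA (r := 1) (by norm_num)).mul_left 1.602)).add
      (hasSum_paircorr hA (r := 1.96) (by norm_num))).add
      ((hasSum_paircorr hA (r := √0.0507) (by positivity)).mul_left 0.167)).add
      ((hasSum_paircorr hA (r := √1.4407) (by positivity)).mul_left 0.334)).add
      ((hasSum_paircorr hA (r := √0.12) (by positivity)).mul_left 0.18)).add
      ((hasSum_paircorr hA (r := √1.72) (by positivity)).mul_left 0.36) |>.congr_fun fun n => by
        rw [bochnerKernel]; ring
  have hK0 := hK.out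
  have hfreq : ∀ n, 0 ≤ frequency K n := fun n => by unfold frequency; positivity
  have := le_hasSum hsum 0 fun n _ => mul_nonneg (by positivity) (bochnerKernel_nonneg (hfreq n))
  rw [setCoeff_zero, Complex.norm_real, Real.norm_eq_abs, sq_abs] at this
  simp only [frequency, Prod.fst_zero, Prod.snd_zero, Int.cast_zero, ne_eq, OfNat.ofNat_ne_zero,
    not_false_eq_true, zero_pow, add_zero, Real.sqrt_zero, mul_zero, bochnerKernel_zero] at this
  linarith

lemma measureReal_inter_preimage (hA : MeasurableSet A) (x y : AddCircle K × AddCircle K) :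
    (torusHaar K).real ((fun z => z + x) ⁻¹' A ∩ (fun z => z + y) ⁻¹' A) =
      autocorr K A (y - x) := by
  have h := measurePreserving_add_right (torusHaar K) x
  rw [autocorr, density_eq, ← h.measureReal_preimage
    (hA.inter (hA.preimage (by fun_prop))).nullMeasurableSet]
  congr 1
  ext z
  simp

/-- A pointwise inclusion-exclusion inequality, integrated. -/
lemma measureReal_inter_add_le {α : Type*} [MeasurableSpace α] (μ : Measure α) [IsFiniteMeasure μ]
    {A X Y Z : Set α} (hA : MeasurableSet A) (hX : MeasurableSet X) (hY : MeasurableSet Y)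
    (hZ : MeasurableSet Z) :
    μ.real (A ∩ X) + μ.real (A ∩ Y) + μ.real (A ∩ Z) ≤
      μ.real A + μ.real (X ∩ Y) + μ.real (X ∩ Z) + μ.real (Y ∩ Z) := by
  have hi : ∀ B, MeasurableSet B → ∫ w, B.indicator 1 w ∂μ = μ.real B :=
    fun B hB => integral_indicator_one hB
  have hint : ∀ B, MeasurableSet B → Integrable (B.indicator (1 : α → ℝ)) μ :=
    fun B hB => (integrable_const (1:ℝ)).indicator hB
  have key := integral_mono
    (((hint _ (hA.inter hX)).add (hint _ (hA.inter hY))).add (hint _ (hA.inter hZ)))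
    ((((hint _ hA).add (hint _ (hX.inter hY))).add (hint _ (hX.inter hZ))).add
      (hint _ (hY.inter hZ))) (fun w => by
        by_cases h1 : w ∈ A <;> by_cases h2 : w ∈ X <;> by_cases h3 : w ∈ Y <;>
          by_cases h4 : w ∈ Z <;> norm_num [h1, h2, h3, h4])
  rwa [integral_add' ((hint _ (hA.inter hX)).add (hint _ (hA.inter hY))) (hint _ (hA.inter hZ)),
    integral_add' (hint _ (hA.inter hX)) (hint _ (hA.inter hY)),
    integral_add' (((hint _ hA).add (hint _ (hX.inter hY))).add (hint _ (hX.inter hZ)))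
      (hint _ (hY.inter hZ)),
    integral_add' ((hint _ hA).add (hint _ (hX.inter hY))) (hint _ (hX.inter hZ)),
    integral_add' (hint _ hA) (hint _ (hX.inter hY)), hi _ hA, hi _ (hA.inter hX),
    hi _ (hA.inter hY), hi _ (hA.inter hZ), hi _ (hX.inter hY), hi _ (hX.inter hZ),
    hi _ (hY.inter hZ)] at key

lemma autocorr_triple_le (hA : MeasurableSet A) (x y z : AddCircle K × AddCircle K) :
    autocorr K A x + autocorr K A y + autocorr K A z ≤
      density K A + autocorr K A (y - x) + autocorr K A (z - x) + autocorr K A (z - y) := by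
  have hm : ∀ x, MeasurableSet ((fun z => z + x) ⁻¹' A) := fun x => hA.preimage (by fun_prop)
  rw [← measureReal_inter_preimage hA x y, ← measureReal_inter_preimage hA x z,
    ← measureReal_inter_preimage hA y z, autocorr, autocorr, autocorr, density_eq, density_eq,
    density_eq, density_eq]
  exact measureReal_inter_add_le _ hA (hm x) (hm y) (hm z)

lemma paircorr_triple_le (hA : MeasurableSet A) (p q r : ℝ × ℝ) :
    paircorr K A (√(p.1 ^ 2 + p.2 ^ 2)) + paircorr K A (√(q.1 ^ 2 + q.2 ^ 2))
      + paircorr K A (√(r.1 ^ 2 + r.2 ^ 2)) ≤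
    density K A + paircorr K A (√((q - p).1 ^ 2 + (q - p).2 ^ 2))
      + paircorr K A (√((r - p).1 ^ 2 + (r - p).2 ^ 2))
      + paircorr K A (√((r - q).1 ^ 2 + (r - q).2 ^ 2)) := by
  have hc : ∀ v, Continuous fun θ => autocorr K A (torusRotate K v θ) := fun v =>
    (continuous_autocorr hA).comp (continuous_torusMk.comp (by fun_prop))
  have hmean : ∀ v : ℝ × ℝ, paircorr K A (√(v.1 ^ 2 + v.2 ^ 2)) =
      circleMean fun θ => autocorr K A (torusRotate K v θ) :=
    fun v => (circleMean_autocorr v.1 v.2).symm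
  simp only [hmean]
  have hp := hc p
  have hq := hc q
  have hr := hc r
  have hqp := hc (q - p)
  have hrp := hc (r - p)
  have hrq := hc (r - q)
  have hpq : Continuous fun θ => autocorr K A (torusRotate K p θ)
      + autocorr K A (torusRotate K q θ) := hp.add hq
  have hdq : Continuous fun θ => density K A + autocorr K A (torusRotate K (q - p) θ) :=
    continuous_const.add hqp
  have hdqr : Continuous fun θ => density K A + autocorr K A (torusRotate K (q - p) θ)
      + autocorr K A (torusRotate K (r - p) θ) := hdq.add hrp
  rw [← circleMean_add hp hq, ← circleMean_add hpq hr, ← circleMean_const (density K A),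
    ← circleMean_add continuous_const hqp, ← circleMean_add hdq hrp, ← circleMean_add hdqr hrq]
  refine circleMean_mono (hpq.add hr) (hdqr.add hrq) fun θ => ?_
  simp only [← torusRotate_sub]
  exact autocorr_triple_le hA _ _ _

/-- The constraint coming from a unit equilateral triangle at distance `√3 q` from the origin. -/
lemma paircorr_triangle_le (hA : MeasurableSet A) {q a b : ℝ} (ha : 3 * q ^ 2 = a)
    (hb : 3 * q ^ 2 + 3 * q + 1 = b) :
    paircorr K A (√a) + 2 * paircorr K A (√b) ≤ density K A + 3 * paircorr K A 1 := by
  have h3 : √3 ^ 2 = (3:ℝ) := Real.sq_sqrt (by norm_num)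
  have h := paircorr_triple_le (K := K) hA (√3 * q, 0) (√3 * q + √3 / 2, 1 / 2)
    (√3 * q + √3 / 2, -(1 / 2))
  simp only [Prod.fst_sub, Prod.snd_sub] at h
  rw [show (√3 * q) ^ 2 + 0 ^ 2 = a by rw [mul_pow, h3, ← ha]; ring,
    show (√3 * q + √3 / 2) ^ 2 + (1 / 2) ^ 2 = b by
      rw [← hb]; linear_combination (q ^ 2 + q + 1 / 4) * h3,
    show (√3 * q + √3 / 2) ^ 2 + (-(1 / 2)) ^ 2 = b by
      rw [← hb]; linear_combination (q ^ 2 + q + 1 / 4) * h3,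
    show (√3 * q + √3 / 2 - √3 * q) ^ 2 + (1 / 2 - 0) ^ 2 = 1 by
      linear_combination (1 / 4) * h3,
    show (√3 * q + √3 / 2 - √3 * q) ^ 2 + (-(1 / 2) - 0) ^ 2 = 1 by
      linear_combination (1 / 4) * h3,
    show (√3 * q + √3 / 2 - (√3 * q + √3 / 2)) ^ 2 + (-(1 / 2) - 1 / 2 : ℝ) ^ 2 = 1 by ring,
    Real.sqrt_one] at h
  linarith

/-- The linear programming bound relating density and pair correlations. -/
lemma density_bound (hA : MeasurableSet A) :
    3.967 * density K A ^ 2 ≤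
      0.671 * density K A + 2.643 * paircorr K A 1 + paircorr K A 1.96 := by
  have h1 := sq_density_le_sum_paircorr hA
  have h2 := paircorr_triangle_le hA (q := 0.13) (a := 0.0507) (b := 1.4407) (by norm_num)
    (by norm_num)
  have h3 := paircorr_triangle_le hA (q := 0.2) (a := 0.12) (b := 1.72) (by norm_num)
    (by norm_num)
  linarith

end PairCorrelation

end

noncomputable section

section HexagonalPacking

/-- The hexagonal lattice of minimal distance `2`. -/
def hexCenter (n : Σ _ : ℤ, ℤ) : ℂ := ⟨2 * n.2 + n.1, √3 * n.1⟩

/-- The open disc of radius `1 / 2` around a point of the hexagonal lattice. -/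
def hexDisc (n : Σ _ : ℤ, ℤ) : Set (ℝ × ℝ) :=
  Complex.measurableEquivRealProd.symm ⁻¹' Metric.ball (hexCenter n) (1 / 2)

lemma mem_hexDisc {n : Σ _ : ℤ, ℤ} {p : ℝ × ℝ} :
    p ∈ hexDisc n ↔ dist (⟨p.1, p.2⟩ : ℂ) (hexCenter n) < 1 / 2 := Iff.rfl

lemma two_le_dist_hexCenter {m n : Σ _ : ℤ, ℤ} (h : m ≠ n) :
    2 ≤ dist (hexCenter m) (hexCenter n) := by
  obtain ⟨j, i⟩ := m
  obtain ⟨l, k⟩ := n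
  have hpos : 1 ≤ (i - k) ^ 2 + (i - k) * (j - l) + (j - l) ^ 2 := by
    by_contra! hlt
    have hj : j - l = 0 := by nlinarith [sq_nonneg (2 * (i - k) + (j - l))]
    have hi : i - k = 0 := by rw [hj] at hlt; nlinarith
    exact h (by rw [sub_eq_zero.mp hj, sub_eq_zero.mp hi])
  have hpos' : (1:ℝ) ≤ ((i:ℝ) - k) ^ 2 + (i - k) * (j - l) + (j - l) ^ 2 := by exact_mod_cast hpos
  have h3 : √3 ^ 2 = (3:ℝ) := Real.sq_sqrt (by norm_num)
  rw [hexCenter, hexCenter, Complex.dist_mk]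
  apply Real.le_sqrt_of_sq_le
  linear_combination 4 * hpos' - (j - l : ℝ) ^ 2 * h3

lemma measurableSet_hexDisc (n : Σ _ : ℤ, ℤ) : MeasurableSet (hexDisc n) :=
  Complex.measurableEquivRealProd.symm.measurable measurableSet_ball

lemma volume_hexDisc (n : Σ _ : ℤ, ℤ) : volume (hexDisc n) = ENNReal.ofReal (Real.pi / 4) := by
  rw [hexDisc, (Complex.volume_preserving_equiv_real_prod.symm).measure_preimage
    measurableSet_ball.nullMeasurableSet, Complex.volume_ball,
    ← ENNReal.ofReal_pow (by norm_num), ← ENNReal.ofReal_coe_nnreal,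
    ← ENNReal.ofReal_mul (by positivity)]
  congr 1
  rw [NNReal.coe_real_pi]; ring

lemma disjoint_hexDisc {m n : Σ _ : ℤ, ℤ} (h : m ≠ n) : Disjoint (hexDisc m) (hexDisc n) := by
  rw [Set.disjoint_left]
  intro p hm hn
  rw [mem_hexDisc] at hm hn
  linarith [two_le_dist_hexCenter h,
    dist_triangle_left (hexCenter m) (hexCenter n) (⟨p.1, p.2⟩ : ℂ)]

lemma avoids1_hexDisc : Avoids1 (⋃ n, hexDisc n) := by
  intro p hp q hq
  obtain ⟨m, hm⟩ := Set.mem_iUnion.mp hp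
  obtain ⟨n, hn⟩ := Set.mem_iUnion.mp hq
  rw [mem_hexDisc] at hm hn
  rw [euDist, ← Complex.dist_mk]
  rcases eq_or_ne m n with rfl | h
  · exact ne_of_lt (by
      linarith [dist_triangle_right (⟨p.1, p.2⟩ : ℂ) ⟨q.1, q.2⟩ (hexCenter m)])
  · have h1 := two_le_dist_hexCenter h
    have h2 := dist_triangle4 (hexCenter m) (⟨p.1, p.2⟩ : ℂ) ⟨q.1, q.2⟩ (hexCenter n)
    rw [dist_comm] at hm
    exact ne_of_gt (by linarith)

lemma hexDisc_subset_Icc {R : ℝ} {n : Σ _ : ℤ, ℤ} (h₁ : |(2 * n.2 + n.1 : ℝ)| ≤ R - 1 / 2)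
    (h₂ : |√3 * n.1| ≤ R - 1 / 2) : hexDisc n ⊆ Set.Icc (-R, -R) (R, R) := by
  intro p hp
  rw [mem_hexDisc, Complex.dist_eq] at hp
  have hre := (Complex.abs_re_le_norm _).trans hp.le
  have him := (Complex.abs_im_le_norm _).trans hp.le
  simp only [hexCenter, Complex.sub_re, Complex.sub_im] at hre him
  rw [abs_le] at *
  refine ⟨⟨?_, ?_⟩, ?_, ?_⟩ <;> simp only <;> linarith

/-- The number of integers in a real interval. -/
lemma sub_sub_one_le_card_Icc (a b : ℝ) : b - a - 1 ≤ ((Finset.Icc ⌈a⌉ ⌊b⌋).card : ℝ) := by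
  have h : ((⌊b⌋ + 1 - ⌈a⌉ : ℤ) : ℝ) ≤ ((Finset.Icc ⌈a⌉ ⌊b⌋).card : ℝ) := by
    rw [Int.card_Icc]; exact_mod_cast Int.self_le_toNat _
  push_cast at h
  linarith [Int.lt_floor_add_one b, Int.ceil_lt_add_one a]

/-- The lattice points whose discs are required to lie in the square `[-R, R]²`. -/
def hexIndices (R : ℝ) : Finset (Σ _ : ℤ, ℤ) :=
  (Finset.Icc ⌈-((R - 1 / 2) / √3)⌉ ⌊(R - 1 / 2) / √3⌋).sigma fun j =>
    Finset.Icc ⌈-((R - 1 / 2) / 2) - j / 2⌉ ⌊(R - 1 / 2) / 2 - (j / 2 : ℝ)⌋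

lemma hexDisc_subset_of_mem {R : ℝ} {n : Σ _ : ℤ, ℤ} (h : n ∈ hexIndices R) :
    hexDisc n ⊆ Set.Icc (-R, -R) (R, R) := by
  have h3 : (0:ℝ) < √3 := by positivity
  simp only [hexIndices, Finset.mem_sigma, Finset.mem_Icc, Int.ceil_le, Int.le_floor] at h
  obtain ⟨⟨h₁, h₂⟩, h₃, h₄⟩ := h
  refine hexDisc_subset_Icc (abs_le.mpr ⟨by linarith, by linarith⟩) (abs_le.mpr ⟨?_, ?_⟩)
  · rw [← neg_div, div_le_iff₀ h3] at h₁; linarith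
  · rw [le_div_iff₀ h3] at h₂; linarith

lemma le_card_hexIndices {R : ℝ} (hR : 2 ≤ R) :
    (2 * ((R - 1 / 2) / √3) - 1) * (R - 3 / 2) ≤ ((hexIndices R).card : ℝ) := by
  rw [hexIndices, Finset.card_sigma]
  push_cast
  calc _ ≤ ((Finset.Icc ⌈-((R - 1 / 2) / √3)⌉ ⌊(R - 1 / 2) / √3⌋).card : ℝ) * (R - 3 / 2) := by
        gcongr
        · linarith
        · linarith [sub_sub_one_le_card_Icc (-((R - 1 / 2) / √3)) ((R - 1 / 2) / √3)]
    _ ≤ _ := by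
        rw [← nsmul_eq_mul]
        refine Finset.card_nsmul_le_sum _ _ _ fun j _ => ?_
        linarith [sub_sub_one_le_card_Icc (-((R - 1 / 2) / 2) - j / 2)
          ((R - 1 / 2) / 2 - (j / 2 : ℝ))]

lemma volume_square {R : ℝ} (hR : 0 ≤ R) :
    volume (Set.Icc ((-R, -R) : ℝ × ℝ) (R, R)) = ENNReal.ofReal ((2 * R) ^ 2) := by
  rw [← Set.Icc_prod_Icc, Measure.volume_eq_prod, Measure.prod_prod, Real.volume_Icc,
    ← ENNReal.ofReal_mul (by linarith)]
  congr 1; ring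

lemma card_hexIndices_mul_le_volume {R : ℝ} (hR : 0 ≤ R) :
    ((hexIndices R).card : ℝ) * (Real.pi / 4) ≤
      (volume ((⋃ n, hexDisc n) ∩ Set.Icc (-R, -R) (R, R))).toReal := by
  have hfin : volume ((⋃ n, hexDisc n) ∩ Set.Icc ((-R, -R) : ℝ × ℝ) (R, R)) ≠ ⊤ :=
    ne_top_of_le_ne_top (by rw [volume_square hR]; exact ENNReal.ofReal_ne_top)
      (measure_mono Set.inter_subset_right)
  have hunion : volume (⋃ n ∈ hexIndices R, hexDisc n) =
      ENNReal.ofReal (((hexIndices R).card : ℝ) * (Real.pi / 4)) := by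
    rw [measure_biUnion_finset (fun m _ n _ h => disjoint_hexDisc h)
      fun n _ => measurableSet_hexDisc n]
    simp [volume_hexDisc, ENNReal.ofReal_mul]
  rw [← ENNReal.ofReal_le_iff_le_toReal hfin, ← hunion]
  refine measure_mono (Set.iUnion₂_subset fun n hn => Set.subset_inter ?_ ?_)
  · exact Set.subset_iUnion hexDisc n
  · exact hexDisc_subset_of_mem hn

lemma volume_inter_square_div_le_one (A : Set (ℝ × ℝ)) {R : ℝ} (hR : 0 ≤ R) :
    (volume (A ∩ Set.Icc (-R, -R) (R, R))).toReal / (2 * R) ^ 2 ≤ 1 := by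
  refine div_le_one_of_le₀ (ENNReal.toReal_le_of_le_ofReal (by positivity) ?_) (by positivity)
  rw [← volume_square hR]
  exact measure_mono Set.inter_subset_right

lemma isBoundedUnder_volume_inter_square (A : Set (ℝ × ℝ)) :
    IsBoundedUnder (· ≤ ·) atTop
      fun R : ℝ => (volume (A ∩ Set.Icc (-R, -R) (R, R))).toReal / (2 * R) ^ 2 :=
  isBoundedUnder_of_eventually_le (a := 1) <|
    (eventually_ge_atTop 0).mono fun _ hR => volume_inter_square_div_le_one A hR

lemma upperDensity_le_one (A : Set (ℝ × ℝ)) : upperDensity A ≤ 1 :=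
  limsup_le_of_le
    (isBoundedUnder_of_eventually_ge (a := 0)
      (Eventually.of_forall fun _ => by positivity)).isCoboundedUnder_le
    ((eventually_ge_atTop 0).mono fun _ hR => volume_inter_square_div_le_one A hR)

lemma le_upperDensity_hexDisc : 0.2266 ≤ upperDensity (⋃ n, hexDisc n) := by
  refine le_limsup_of_frequently_le (Eventually.frequently ?_)
    (isBoundedUnder_volume_inter_square _)
  filter_upwards [eventually_ge_atTop 100000] with R hR
  rw [le_div_iff₀ (by positivity)]
  have h3 : 0.57735 * (R - 1 / 2) ≤ (R - 1 / 2) / √3 := by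
    have hs : √3 ≤ 1.732051 := by rw [Real.sqrt_le_left (by norm_num)]; norm_num
    rw [le_div_iff₀ (by positivity)]
    nlinarith
  have hpi := Real.pi_gt_d4
  have hcard := le_card_hexIndices (R := R) (by linarith)
  have hcount : 1.1546 * R ^ 2 ≤ ((hexIndices R).card : ℝ) := by nlinarith
  nlinarith [card_hexIndices_mul_le_volume (R := R) (by linarith)]

lemma le_m1Plane : 0.2266 ≤ m1Plane := by
  refine le_upperDensity_hexDisc.trans (le_csSup ⟨1, ?_⟩
    ⟨_, MeasurableSet.iUnion measurableSet_hexDisc, avoids1_hexDisc, rfl⟩)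
  rintro _ ⟨A, -, -, rfl⟩
  exact upperDensity_le_one A

end HexagonalPacking

end

/-- There exists `γ > 0` such that for every `K > 0` and every measurable
`A ⊆ 𝕋_K²` with `s(1; A) ≤ γ` and `δ(A) ≥ m₁(ℝ²) - γ`, one has `s(1.96; A) ≥ 1 + γ`. -/
theorem dense_avoiding_sets_cluster :
    ∃ γ > (0:ℝ), ∀ (K : ℝ), 0 < K → ∀ A : Set (AddCircle K × AddCircle K),
      MeasurableSet A → scorr K A 1 ≤ γ → m1Plane - γ ≤ density K A →
      1 + γ ≤ scorr K A 1.96 := by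
  refine ⟨0.00001, by norm_num, fun K hK A hA h1 hd => ?_⟩
  have : Fact (0 < K) := ⟨hK⟩
  have hδ : 0.2265 ≤ density K A := by linarith [le_m1Plane]
  have hsq : 0 < density K A ^ 2 := by positivity
  rw [scorr, div_le_iff₀ hsq] at h1
  rw [scorr, le_div_iff₀ hsq]
  nlinarith [density_bound (K := K) hA]
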